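/- With Θ the context-free grammar constructed from a confluent context-free monadic rewriting system (A,R): for all u, w ∈ A*, w ⇒*_R u if and only if $̃_{uʳᵉᵛ} ⇒*_Θ wʳᵉᵛ. -/

import Mathlib

/-! Common framework: string rewriting systems and the grammar Θ constructed from a
confluent context-free monadic rewriting system `(A, R)`. -/

/-- Words over the alphabet `A`. -/
abbrev Word (A : Type) : Type := List A

/-- The word (of length at most one) corresponding to an element of `A ∪ {ε}`. -/
def toWord {A : Type} (a : Option A) : Word A := a.elim [] (fun b => [b])

/-- One rewriting step of the string rewriting system `R`. -/
def RWStep {A : Type} (R : Set (Word A × Word A)) (u v : Word A) : Prop :=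
  ∃ (x y l r : Word A), (l, r) ∈ R ∧ u = x ++ l ++ y ∧ v = x ++ r ++ y

/-- The reduction relation `⇒*_R`. -/
abbrev RWDerives {A : Type} (R : Set (Word A × Word A)) : Word A → Word A → Prop :=
  Relation.ReflTransGen (RWStep R)

/-- Equality in the monoid presented by `⟨A | R⟩`. -/
abbrev MonEq {A : Type} (R : Set (Word A × Word A)) : Word A → Word A → Prop :=
  Relation.EqvGen (RWStep R)

/-- Confluence of the rewriting system. -/
def RWConfluent {A : Type} (R : Set (Word A × Word A)) : Prop :=
  ∀ u u' u'' : Word A, RWDerives R u u' → RWDerives R u u'' →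
    ∃ v : Word A, RWDerives R u' v ∧ RWDerives R u'' v

/-- Monadic: length-reducing with right-hand sides in `A ∪ {ε}`. -/
def RWMonadic {A : Type} (R : Set (Word A × Word A)) : Prop :=
  ∀ p ∈ R, p.2.length < p.1.length ∧ p.2.length ≤ 1

/-- Terminal alphabet of the auxiliary grammar `Δ`:
the symbols `$_a`, `$̃_a` (for `a ∈ A ∪ {ε}`) together with `#₂`. -/
inductive DollarT (A : Type) : Type
  | dol : Option A → DollarT A
  | tdol : Option A → DollarT A
  | hash : DollarT A

/-- `$_p` as a word over `DollarT A`: `$_{p₁}⋯$_{p_n}` for `p ≠ ε`,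
and the single letter `$_ε` for `p = ε`. -/
def dW {A : Type} : Word A → List (DollarT A)
  | [] => [DollarT.dol none]
  | p => p.map (fun b => DollarT.dol (some b))

/-- `$̃_p` as a word over `DollarT A`. -/
def tdW {A : Type} : Word A → List (DollarT A)
  | [] => [DollarT.tdol none]
  | p => p.map (fun b => DollarT.tdol (some b))

/-- Nonterminals of `Θ`: the nonterminals of `Δ`, the symbols `$_a` and `$̃_a`
(`a ∈ A ∪ {ε}`), and the (pairwise disjoint) nonterminals of the grammars `Γ'_a`
and `Γ''_a`. -/
inductive ThetaNT (A : Type) (Γ : Option A → ContextFreeGrammar.{0} A)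
    (Δ : ContextFreeGrammar.{0} (DollarT A)) : Type
  | delta : Δ.NT → ThetaNT A Γ Δ
  | dol : Option A → ThetaNT A Γ Δ
  | tdol : Option A → ThetaNT A Γ Δ
  | prime : (a : Option A) → (Γ a).NT → ThetaNT A Γ Δ
  | dprime : (a : Option A) → (Γ a).NT → ThetaNT A Γ Δ

variable {A : Type} (Γ : Option A → ContextFreeGrammar.{0} A)
  (Δ : ContextFreeGrammar.{0} (DollarT A))

/-- Translation of symbols of `Γ_a` into symbols of `Θ`, realising `Γ'_a`:
each terminal `b` is replaced by the nonterminal `$_b`. -/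
def primeSym (a : Option A) : Symbol A (Γ a).NT → Symbol (Option A) (ThetaNT A Γ Δ)
  | Symbol.terminal b => Symbol.nonterminal (ThetaNT.dol (some b))
  | Symbol.nonterminal n => Symbol.nonterminal (ThetaNT.prime a n)

/-- Translation of symbols of `Γ_a` into symbols of `Θ`, realising `Γ''_a`:
each terminal `b` is replaced by the nonterminal `$̃_b`. -/
def dprimeSym (a : Option A) : Symbol A (Γ a).NT → Symbol (Option A) (ThetaNT A Γ Δ)
  | Symbol.terminal b => Symbol.nonterminal (ThetaNT.tdol (some b))
  | Symbol.nonterminal n => Symbol.nonterminal (ThetaNT.dprime a n)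

/-- Translation of symbols of `Δ` into symbols of `Θ`: the terminals `$_a`, `$̃_a`
of `Δ` become nonterminals of `Θ`, and `#₂` stays a terminal (encoded as `none`). -/
def deltaSym : Symbol (DollarT A) Δ.NT → Symbol (Option A) (ThetaNT A Γ Δ)
  | Symbol.terminal (DollarT.dol a) => Symbol.nonterminal (ThetaNT.dol a)
  | Symbol.terminal (DollarT.tdol a) => Symbol.nonterminal (ThetaNT.tdol a)
  | Symbol.terminal DollarT.hash => Symbol.terminal none
  | Symbol.nonterminal n => Symbol.nonterminal (ThetaNT.delta n)

/-- The productions of `Θ`: those of `Δ`, those of all `Γ'_a` and `Γ''_a`, the insertion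
productions `$_a → $_a $_ε`, `$_a → $_ε $_a`, `$̃_a → $̃_a $̃_ε`, `$̃_a → $̃_ε $̃_a`, the
start productions `$_a → O'_a`, `$̃_a → O''_a`, and the terminal productions
`$_a → a`, `$̃_a → a` (with `$_ε → ε`, `$̃_ε → ε`). -/
noncomputable def thetaRules [Fintype A] : List (ContextFreeRule (Option A) (ThetaNT A Γ Δ)) :=
  (Δ.rules.toList.map (fun r =>
    ⟨ThetaNT.delta r.input, r.output.map (deltaSym Γ Δ)⟩))
  ++ ((Finset.univ : Finset (Option A)).toList.flatMap (fun a =>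
      ((Γ a).rules.toList.map (fun r =>
        ⟨ThetaNT.prime a r.input, r.output.map (primeSym Γ Δ a)⟩))
      ++ ((Γ a).rules.toList.map (fun r =>
        ⟨ThetaNT.dprime a r.input, r.output.reverse.map (dprimeSym Γ Δ a)⟩))
      ++ [⟨ThetaNT.dol a, [Symbol.nonterminal (ThetaNT.dol a),
             Symbol.nonterminal (ThetaNT.dol none)]⟩,
          ⟨ThetaNT.dol a, [Symbol.nonterminal (ThetaNT.dol none),
             Symbol.nonterminal (ThetaNT.dol a)]⟩,
          ⟨ThetaNT.tdol a, [Symbol.nonterminal (ThetaNT.tdol a),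
             Symbol.nonterminal (ThetaNT.tdol none)]⟩,
          ⟨ThetaNT.tdol a, [Symbol.nonterminal (ThetaNT.tdol none),
             Symbol.nonterminal (ThetaNT.tdol a)]⟩,
          ⟨ThetaNT.dol a, [Symbol.nonterminal (ThetaNT.prime a (Γ a).initial)]⟩,
          ⟨ThetaNT.tdol a, [Symbol.nonterminal (ThetaNT.dprime a (Γ a).initial)]⟩,
          ⟨ThetaNT.dol a, (toWord a).map (fun b => Symbol.terminal (some b))⟩,
          ⟨ThetaNT.tdol a, (toWord a).map (fun b => Symbol.terminal (some b))⟩]))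

/-- The grammar `Θ`, over the terminal alphabet `A ∪ {#₂}` (encoded as `Option A`
with `none = #₂`), with start symbol `O_Δ`. -/
noncomputable def Theta [Fintype A] : ContextFreeGrammar.{0} (Option A) :=
  { NT := ThetaNT A Γ Δ
    initial := ThetaNT.delta Δ.initial
    rules := @List.toFinset _ (Classical.decEq _) (thetaRules Γ Δ) }

/-- `$_p` as a string of symbols of `Θ` (the single letter `$_ε` when `p = ε`). -/
def dols : Word A → List (Symbol (Option A) (ThetaNT A Γ Δ))
  | [] => [Symbol.nonterminal (ThetaNT.dol none)]
  | p => p.map (fun b => Symbol.nonterminal (ThetaNT.dol (some b)))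

/-- `$̃_p` as a string of symbols of `Θ` (the single letter `$̃_ε` when `p = ε`). -/
def tdols : Word A → List (Symbol (Option A) (ThetaNT A Γ Δ))
  | [] => [Symbol.nonterminal (ThetaNT.tdol none)]
  | p => p.map (fun b => Symbol.nonterminal (ThetaNT.tdol (some b)))

/-- A word over `A` as a string of terminal symbols of `Θ`. -/
def terms : Word A → List (Symbol (Option A) (ThetaNT A Γ Δ)) :=
  fun u => u.map (fun b => Symbol.terminal (some b))

namespace RWStep

variable {R : Set (Word A × Word A)}

theorem append_left (x : Word A) {u v : Word A} (h : RWStep R u v) :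
    RWStep R (x ++ u) (x ++ v) := by
  obtain ⟨p, q, l, r, hlr, rfl, rfl⟩ := h
  exact ⟨x ++ p, q, l, r, hlr, by simp, by simp⟩

theorem append_right (y : Word A) {u v : Word A} (h : RWStep R u v) :
    RWStep R (u ++ y) (v ++ y) := by
  obtain ⟨p, q, l, r, hlr, rfl, rfl⟩ := h
  exact ⟨p, q ++ y, l, r, hlr, by simp, by simp⟩

end RWStep

theorem RWDerives.append {R : Set (Word A × Word A)} {u u' v v' : Word A}
    (hu : RWDerives R u u') (hv : RWDerives R v v') : RWDerives R (u ++ v) (u' ++ v') :=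
  (Relation.ReflTransGen.lift (· ++ v) (fun _ _ => RWStep.append_right v) _ _ hu).trans
    (Relation.ReflTransGen.lift (u' ++ ·) (fun _ _ => RWStep.append_left u') _ _ hv)

theorem RWDerives.of_mem {R : Set (Word A × Word A)} {l r : Word A} (h : (l, r) ∈ R) :
    RWDerives R l r :=
  .single ⟨[], [], l, r, h, by simp, by simp⟩

theorem ContextFreeGrammar.Derives.append {T : Type*} {g : ContextFreeGrammar T}
    {u u' v v' : List (Symbol T g.NT)} (hu : g.Derives u u') (hv : g.Derives v v') :
    g.Derives (u ++ v) (u' ++ v') :=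
  (hu.append_right v).trans (hv.append_left u')

section Theta

variable {Γ Δ}

theorem tdols_of_ne_nil {p : Word A} (hp : p ≠ []) :
    tdols Γ Δ p = p.map fun b => .nonterminal (.tdol (some b)) := by
  cases p <;> simp_all [tdols]

theorem exists_toWord_eq {r : Word A} (hr : r.length ≤ 1) : ∃ a, toWord a = r := by
  match r, hr with
  | [], _ => exact ⟨none, rfl⟩
  | [b], _ => exact ⟨some b, rfl⟩

variable [Fintype A]

theorem mem_Theta_rules {r : ContextFreeRule (Option A) (ThetaNT A Γ Δ)} :
    r ∈ (Theta Γ Δ).rules ↔ r ∈ thetaRules Γ Δ := by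
  exact @List.mem_toFinset _ (Classical.decEq _) _ _

theorem Theta_produces_exists_parts {s t : List (Symbol (Option A) (ThetaNT A Γ Δ))}
    (h : (Theta Γ Δ).Produces s t) :
    ∃ r ∈ thetaRules Γ Δ, ∃ p q : List (Symbol (Option A) (ThetaNT A Γ Δ)),
      s = p ++ [.nonterminal r.input] ++ q ∧ t = p ++ r.output ++ q := by
  obtain ⟨r, hr, hst⟩ := h
  exact ⟨r, mem_Theta_rules.1 hr, hst.exists_parts⟩

variable (Γ Δ) in
/-- The derivation relation of `Θ`, on words whose nonterminals are literally in `ThetaNT`. -/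
def ThetaDerives : List (Symbol (Option A) (ThetaNT A Γ Δ)) →
    List (Symbol (Option A) (ThetaNT A Γ Δ)) → Prop :=
  (Theta Γ Δ).Derives

namespace ThetaDerives

variable {s t s' t' : List (Symbol (Option A) (ThetaNT A Γ Δ))}

theorem refl (s : List (Symbol (Option A) (ThetaNT A Γ Δ))) : ThetaDerives Γ Δ s s :=
  Relation.ReflTransGen.refl

theorem trans {u : List (Symbol (Option A) (ThetaNT A Γ Δ))} (h : ThetaDerives Γ Δ s t)
    (h' : ThetaDerives Γ Δ t u) : ThetaDerives Γ Δ s u :=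
  ContextFreeGrammar.Derives.trans h h'

theorem append (h : ThetaDerives Γ Δ s t) (h' : ThetaDerives Γ Δ s' t') :
    ThetaDerives Γ Δ (s ++ s') (t ++ t') :=
  ContextFreeGrammar.Derives.append h h'

theorem append_left (h : ThetaDerives Γ Δ s t) (x : List (Symbol (Option A) (ThetaNT A Γ Δ))) :
    ThetaDerives Γ Δ (x ++ s) (x ++ t) :=
  (refl x).append h

theorem append_right (h : ThetaDerives Γ Δ s t) (x : List (Symbol (Option A) (ThetaNT A Γ Δ))) :
    ThetaDerives Γ Δ (s ++ x) (t ++ x) :=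
  h.append (refl x)

end ThetaDerives

theorem ThetaDerives.of_mem_rules {n : ThetaNT A Γ Δ} {s : List (Symbol (Option A) (ThetaNT A Γ Δ))}
    (h : ⟨n, s⟩ ∈ thetaRules Γ Δ) : ThetaDerives Γ Δ [.nonterminal n] s :=
  ContextFreeGrammar.Produces.single
    ⟨⟨n, s⟩, mem_Theta_rules.2 h, ContextFreeRule.Rewrites.input_output⟩

theorem thetaDerives_tdol_insert_right (a : Option A) :
    ThetaDerives Γ Δ [.nonterminal (.tdol a)] [.nonterminal (.tdol a), .nonterminal (.tdol none)] :=
  .of_mem_rules <| by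
    simp only [thetaRules, List.mem_append, List.mem_flatMap]
    exact .inr ⟨a, by simp, .inr (by simp)⟩

theorem thetaDerives_tdol_insert_left (a : Option A) :
    ThetaDerives Γ Δ [.nonterminal (.tdol a)] [.nonterminal (.tdol none), .nonterminal (.tdol a)] :=
  .of_mem_rules <| by
    simp only [thetaRules, List.mem_append, List.mem_flatMap]
    exact .inr ⟨a, by simp, .inr (by simp)⟩

theorem thetaDerives_tdol_start (a : Option A) :
    ThetaDerives Γ Δ [.nonterminal (.tdol a)] [.nonterminal (.dprime a (Γ a).initial)] :=
  .of_mem_rules <| by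
    simp only [thetaRules, List.mem_append, List.mem_flatMap]
    exact .inr ⟨a, by simp, .inr (by simp)⟩

theorem thetaDerives_tdol_toWord (a : Option A) :
    ThetaDerives Γ Δ [.nonterminal (.tdol a)] (terms Γ Δ (toWord a)) :=
  .of_mem_rules <| by
    simp only [thetaRules, List.mem_append, List.mem_flatMap]
    exact .inr ⟨a, by simp, .inr (by simp [terms])⟩

theorem thetaDerives_dprimeSym {a : Option A} {s t : List (Symbol A (Γ a).NT)}
    (h : (Γ a).Derives s t) :
    ThetaDerives Γ Δ (s.reverse.map (dprimeSym Γ Δ a)) (t.reverse.map (dprimeSym Γ Δ a)) := by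
  induction h with
  | refl => exact .refl _
  | tail _ hstep ih =>
  refine ih.trans ?_
  obtain ⟨r, hr, hst⟩ := hstep
  obtain ⟨p, q, rfl, rfl⟩ := hst.exists_parts
  have hp : ThetaDerives Γ Δ [.nonterminal (.dprime a r.input)]
      (r.output.reverse.map (dprimeSym Γ Δ a)) := by
    apply ThetaDerives.of_mem_rules
    simp only [thetaRules, List.mem_append, List.mem_flatMap]
    exact .inr ⟨a, by simp, .inl (.inr (List.mem_map.2 ⟨r, by simpa using hr, rfl⟩))⟩
  simpa [dprimeSym] using (hp.append_right (p.reverse.map (dprimeSym Γ Δ a))).append_left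
    (q.reverse.map (dprimeSym Γ Δ a))

theorem thetaDerives_tdol_of_mem {a : Option A} {l : Word A}
    (h : l ∈ (Γ a).language) (hl : l ≠ []) :
    ThetaDerives Γ Δ [.nonterminal (.tdol a)] (tdols Γ Δ l.reverse) := by
  rw [tdols_of_ne_nil (by simpa using hl)]
  refine (thetaDerives_tdol_start a).trans ?_
  have := thetaDerives_dprimeSym (Δ := Δ) ((ContextFreeGrammar.mem_language_iff _ _).1 h)
  rwa [← List.map_reverse, List.map_map] at this

theorem thetaDerives_tdols_terms (p : Word A) :
    ThetaDerives Γ Δ (tdols Γ Δ p) (terms Γ Δ p) := by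
  by_cases hp : p = []
  · subst hp
    exact thetaDerives_tdol_toWord none
  · rw [tdols_of_ne_nil hp]
    clear hp
    induction p with
    | nil => exact .refl _
    | cons b p ih => exact (thetaDerives_tdol_toWord (some b)).append ih

/-- An erased factor can be reinserted anywhere in a word of the symbols `$̃`. -/
theorem thetaDerives_tdols_insert_none (x y : Word A) :
    ThetaDerives Γ Δ (tdols Γ Δ (x ++ y))
      (x.map (fun b => .nonterminal (.tdol (some b))) ++ [.nonterminal (.tdol none)] ++
        y.map (fun b => .nonterminal (.tdol (some b)))) := by
  cases y with
  | cons b y =>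
    rw [tdols_of_ne_nil (by simp)]
    simpa using ((thetaDerives_tdol_insert_left (Γ := Γ) (Δ := Δ) (some b)).append_right
      (y.map fun b => .nonterminal (.tdol (some b)))).append_left
        (x.map fun b => .nonterminal (.tdol (some b)))
  | nil =>
    rcases List.eq_nil_or_concat x with rfl | ⟨x, b, rfl⟩
    · exact .refl _
    · rw [tdols_of_ne_nil (by simp)]
      simpa using (thetaDerives_tdol_insert_right (Γ := Γ) (Δ := Δ) (some b)).append_left
        (x.map fun b => .nonterminal (.tdol (some b)))

theorem thetaDerives_tdols_append_toWord (x y : Word A) (a : Option A) :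
    ThetaDerives Γ Δ (tdols Γ Δ (x ++ toWord a ++ y))
      (x.map (fun b => .nonterminal (.tdol (some b))) ++ [.nonterminal (.tdol a)] ++
        y.map (fun b => .nonterminal (.tdol (some b)))) := by
  cases a with
  | none => simpa [toWord] using thetaDerives_tdols_insert_none x y
  | some a =>
    rw [tdols_of_ne_nil (by simp [toWord])]
    simpa [toWord] using ThetaDerives.refl _

theorem thetaDerives_tdols_of_step {R : Set (Word A × Word A)} (hmon : RWMonadic R)
    (hΓ : ∀ a : Option A, (Γ a).language = {l : Word A | (l, toWord a) ∈ R})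
    {w u : Word A} (h : RWStep R w u) :
    ThetaDerives Γ Δ (tdols Γ Δ u.reverse) (tdols Γ Δ w.reverse) := by
  obtain ⟨x, y, l, r, hlr, rfl, rfl⟩ := h
  obtain ⟨hlt, hle⟩ := hmon _ hlr
  obtain ⟨a, rfl⟩ := exists_toWord_eq hle
  have hl : l ≠ [] := by rintro rfl; simp at hlt
  have hmem : l ∈ (Γ a).language := by rw [hΓ]; exact hlr
  have ha : (toWord a).reverse = toWord a := by cases a <;> rfl
  have h₁ := thetaDerives_tdols_append_toWord (Γ := Γ) (Δ := Δ) y.reverse x.reverse a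
  have h₂ := ((thetaDerives_tdol_of_mem (Δ := Δ) hmem hl).append_left
    (y.reverse.map fun b => .nonterminal (.tdol (some b)))).append_right
    (x.reverse.map fun b => .nonterminal (.tdol (some b)))
  rw [tdols_of_ne_nil (p := l.reverse) (by simpa using hl)] at h₂
  rw [tdols_of_ne_nil (p := (x ++ l ++ y).reverse) (by simp [hl])]
  simpa [ha] using h₁.trans (by simpa using h₂)

theorem thetaDerives_tdols_of_rwDerives {R : Set (Word A × Word A)} (hmon : RWMonadic R)
    (hΓ : ∀ a : Option A, (Γ a).language = {l : Word A | (l, toWord a) ∈ R})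
    {w u : Word A} (h : RWDerives R w u) :
    ThetaDerives Γ Δ (tdols Γ Δ u.reverse) (tdols Γ Δ w.reverse) := by
  induction h with
  | refl => exact .refl _
  | tail _ hstep ih => exact (thetaDerives_tdols_of_step hmon hΓ hstep).trans ih

end Theta

section Interpretation

variable (R : Set (Word A × Word A))

/-- An interpretation of the symbols of `Θ` as languages over `A`, for which every production
of `Θ` is an inclusion. It is informative only on terminals and the symbols `$̃_a` and
nonterminals of `Γ''_a`. -/
def interp : Symbol (Option A) (ThetaNT A Γ Δ) → Language A
  | .terminal (some b) => {[b]}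
  | .nonterminal (.tdol a) => {v | RWDerives R v.reverse (toWord a)}
  | .nonterminal (.dprime a n) => {v | ∃ z : Word A,
      (Γ a).Derives [.nonterminal n] (z.map .terminal) ∧ RWDerives R v.reverse z}
  | _ => ⊤

variable {Γ Δ R}

theorem mem_interp_tdol {a : Option A} {v : Word A} :
    v ∈ interp Γ Δ R (.nonterminal (.tdol a)) ↔ RWDerives R v.reverse (toWord a) :=
  .rfl

theorem exists_derives_of_mem_interp_dprimeSym {a : Option A} {x : Symbol A (Γ a).NT} {v : Word A}
    (h : v ∈ interp Γ Δ R (dprimeSym Γ Δ a x)) :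
    ∃ z : Word A, (Γ a).Derives [x] (z.map .terminal) ∧ RWDerives R v.reverse z := by
  cases x with
  | terminal b => exact ⟨[b], .refl _, h⟩
  | nonterminal n => exact h

theorem exists_derives_of_mem_prod_interp {a : Option A} {s : List (Symbol A (Γ a).NT)}
    {v : Word A}
    (h : v ∈ ((s.reverse.map (dprimeSym Γ Δ a)).map (interp Γ Δ R)).prod) :
    ∃ z : Word A, (Γ a).Derives s (z.map .terminal) ∧ RWDerives R v.reverse z := by
  induction s generalizing v with
  | nil =>
    obtain rfl : v = [] := by simpa [Language.mem_one] using h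
    exact ⟨[], .refl _, .refl⟩
  | cons x s ih =>
    simp only [List.reverse_cons, List.map_append, List.prod_append, List.map_cons, List.map_nil,
      List.prod_singleton] at h
    obtain ⟨v₁, h₁, v₂, h₂, rfl⟩ := Language.mem_mul.1 h
    obtain ⟨z₁, hd₁, hr₁⟩ := ih h₁
    obtain ⟨z₂, hd₂, hr₂⟩ := exists_derives_of_mem_interp_dprimeSym h₂
    refine ⟨z₂ ++ z₁, ?_, ?_⟩
    · simpa using hd₂.append hd₁
    · simpa using RWDerives.append hr₂ hr₁

theorem reverse_derives_of_mem_prod_interp_tdols {p v : Word A}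
    (h : v ∈ ((tdols Γ Δ p).map (interp Γ Δ R)).prod) : RWDerives R v.reverse p.reverse := by
  by_cases hp : p = []
  · subst hp
    simpa [tdols, mem_interp_tdol, toWord] using h
  · rw [tdols_of_ne_nil hp] at h
    clear hp
    induction p generalizing v with
    | nil =>
      obtain rfl : v = [] := by simpa [Language.mem_one] using h
      exact .refl
    | cons b p ih =>
      simp only [List.map_cons, List.prod_cons] at h
      obtain ⟨v₁, h₁, v₂, h₂, rfl⟩ := Language.mem_mul.1 h
      simpa [toWord] using RWDerives.append (ih h₂) (mem_interp_tdol.1 h₁)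

theorem mem_prod_interp_terms {v w : Word A} :
    v ∈ ((terms Γ Δ w).map (interp Γ Δ R)).prod ↔ v = w := by
  induction w generalizing v with
  | nil => exact Language.mem_one v
  | cons b w ih =>
    refine Language.mem_mul.trans ⟨?_, ?_⟩
    · rintro ⟨_, rfl, v, hv, rfl⟩
      rw [ih.1 hv, List.singleton_append]
    · rintro rfl
      exact ⟨[b], rfl, w, ih.2 rfl, rfl⟩

variable [Fintype A]

theorem prod_interp_output_le
    (hΓ : ∀ a : Option A, (Γ a).language = {l : Word A | (l, toWord a) ∈ R})
    {r : ContextFreeRule (Option A) (ThetaNT A Γ Δ)} (hr : r ∈ thetaRules Γ Δ) :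
    (r.output.map (interp Γ Δ R)).prod ≤ interp Γ Δ R (.nonterminal r.input) := by
  simp only [thetaRules, List.mem_append, List.mem_flatMap, List.mem_map, List.mem_cons,
    List.not_mem_nil, or_false] at hr
  rcases hr with ⟨r, -, rfl⟩ | ⟨a, -, (⟨r, -, rfl⟩ | ⟨r, hr, rfl⟩) |
    (rfl | rfl | rfl | rfl | rfl | rfl | rfl | rfl)⟩
  · exact le_top
  · exact le_top
  · intro v hv
    obtain ⟨z, hd, hz⟩ := exists_derives_of_mem_prod_interp hv
    exact ⟨z, ContextFreeGrammar.Produces.trans_derives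
      ⟨r, by simpa using hr, ContextFreeRule.Rewrites.input_output⟩ hd, hz⟩
  · exact le_top
  · exact le_top
  · intro v hv
    simp only [List.map_cons, List.map_nil, List.prod_cons, List.prod_nil, mul_one] at hv
    obtain ⟨v₁, h₁, v₂, h₂, rfl⟩ := Language.mem_mul.1 hv
    have := RWDerives.append (mem_interp_tdol.1 h₂) (mem_interp_tdol.1 h₁)
    refine mem_interp_tdol.2 ?_
    simpa [toWord] using this
  · intro v hv
    simp only [List.map_cons, List.map_nil, List.prod_cons, List.prod_nil, mul_one] at hv
    obtain ⟨v₁, h₁, v₂, h₂, rfl⟩ := Language.mem_mul.1 hv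
    have := RWDerives.append (mem_interp_tdol.1 h₂) (mem_interp_tdol.1 h₁)
    refine mem_interp_tdol.2 ?_
    simpa [toWord] using this
  · exact le_top
  · intro v hv
    simp only [List.map_cons, List.map_nil, List.prod_singleton] at hv
    obtain ⟨z, hd, hz⟩ := hv
    have hmem : z ∈ (Γ a).language := (ContextFreeGrammar.mem_language_iff _ _).2 hd
    rw [hΓ] at hmem
    exact hz.trans (RWDerives.of_mem hmem)
  · exact le_top
  · intro v hv
    obtain rfl := mem_prod_interp_terms.1 hv
    have ha : (toWord a).reverse = toWord a := by cases a <;> rfl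
    exact mem_interp_tdol.2 (by rw [ha])

theorem prod_interp_le_of_derives
    (hΓ : ∀ a : Option A, (Γ a).language = {l : Word A | (l, toWord a) ∈ R})
    {s t : List (Symbol (Option A) (ThetaNT A Γ Δ))} (h : ThetaDerives Γ Δ s t) :
    (t.map (interp Γ Δ R)).prod ≤ (s.map (interp Γ Δ R)).prod := by
  induction h with
  | refl => exact le_rfl
  | tail _ hstep ih =>
    refine le_trans ?_ ih
    obtain ⟨r, hr, p, q, rfl, rfl⟩ := Theta_produces_exists_parts hstep
    simp only [List.map_append, List.prod_append, List.map_cons, List.map_nil, List.prod_singleton]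
    gcongr
    exact prod_interp_output_le hΓ hr

end Interpretation

/-- **Lemma 3.6.** For all `u, w ∈ A*`, `w ⇒*_R u` if and only if
`$̃_{uʳᵉᵛ} ⇒*_Θ wʳᵉᵛ`. -/
theorem rwDerives_iff_derives_tdols_reverse
    {A : Type} [Fintype A] (R : Set (Word A × Word A))
    (hconf : RWConfluent R) (hmon : RWMonadic R)
    (Γ : Option A → ContextFreeGrammar.{0} A)
    (hΓ : ∀ a : Option A, (Γ a).language = {l : Word A | (l, toWord a) ∈ R})
    (hΓeps : ∀ a : Option A, ∀ r ∈ (Γ a).rules, r.output ≠ [])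
    (Δ : ContextFreeGrammar.{0} (DollarT A))
    (hΔ : Δ.language =
      {x | ∃ p : Word A, x = dW p ++ [DollarT.hash] ++ tdW p.reverse}) :
    ∀ u w : Word A,
      RWDerives R w u ↔
        (Theta Γ Δ).Derives (tdols Γ Δ u.reverse) ((terms Γ Δ w).reverse) := by
  intro u w
  have hrev : (terms Γ Δ w).reverse = terms Γ Δ w.reverse := by simp [terms]
  rw [hrev]
  constructor
  · intro h
    exact (thetaDerives_tdols_of_rwDerives hmon hΓ h).trans (thetaDerives_tdols_terms _)
  · intro h
    simpa using reverse_derives_of_mem_prod_interp_tdols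
      (prod_interp_le_of_derives hΓ h (mem_prod_interp_terms.2 rfl))
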